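/- Let Σ = {σ₁,…,σₙ} be a finite family of injective non-unital ring endomorphisms of a ring R with R Σ-semicommutative, and let Δ = {δ₁,…,δₙ} be a family of maps where each δᵢ is a σᵢ-derivation of R. Then for every idempotent e of R one has δᵢ(e) = 0 for each i, and consequently δ^β(e) = 0 for every β ∈ ℕⁿ with β ≠ (0,…,0). -/

import Mathlib

/-- A non-unital ring endomorphism: an additive and multiplicative map
(not required to send `1` to `1`). -/
def IsNUEnd {R : Type*} [Ring R] (σ : R → R) : Prop :=
  (∀ a b : R, σ (a + b) = σ a + σ b) ∧ (∀ a b : R, σ (a * b) = σ a * σ b)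

/-- For a family `σ : Fin n → R → R` and `α ∈ ℕⁿ`, the composition
`σ₁^{α₁} ∘ ⋯ ∘ σₙ^{αₙ}`. -/
def famPow {R : Type*} {n : ℕ} (σ : Fin n → R → R) (α : Fin n → ℕ) : R → R :=
  (List.ofFn (fun i => (σ i)^[α i])).foldr (· ∘ ·) id

/-- `R` is `Σ`-semicommutative: `a * b = 0` implies `a * r * σ^α(b) = 0`
for every `r ∈ R` and every `α ≠ 0`. -/
def SigmaSemicomm {R : Type*} [Ring R] {n : ℕ} (σ : Fin n → R → R) : Prop :=
  ∀ a b : R, a * b = 0 → ∀ r : R, ∀ α : Fin n → ℕ, α ≠ 0 → a * r * famPow σ α b = 0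

/-- `R` is `σ`-semicommutative (single endomorphism). -/
def SingleSemicomm {R : Type*} [Ring R] (σ : R → R) : Prop :=
  ∀ a b : R, a * b = 0 → ∀ r : R, a * r * σ b = 0

/-- `R` is `Σ`-rigid: `a * σ^α(a) = 0` implies `a = 0`. -/
def SigmaRigid {R : Type*} [Ring R] {n : ℕ} (σ : Fin n → R → R) : Prop :=
  ∀ (a : R) (α : Fin n → ℕ), a * famPow σ α a = 0 → a = 0

/-- `δ` is a `σ`-derivation of `R`. -/
def IsSigmaDerivation {R : Type*} [Ring R] (σ δ : R → R) : Prop :=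
  (∀ a b : R, δ (a + b) = δ a + δ b) ∧
    (∀ a b : R, δ (a * b) = σ a * δ b + δ a * b)

/-- The left annihilator `l_R(S)` of a subset `S ⊆ R`. -/
def leftAnn {R : Type*} [Ring R] (S : Set R) : Set R :=
  {x : R | ∀ s ∈ S, x * s = 0}

/-- The right annihilator `r_R(S)` of a subset `S ⊆ R`. -/
def rightAnn {R : Type*} [Ring R] (S : Set R) : Set R :=
  {x : R | ∀ s ∈ S, s * x = 0}

/-- `R` is Baer (left annihilator version): the left annihilator of every
nonempty subset is of the form `Re` for an idempotent `e`. -/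
def IsBaerLeft (R : Type*) [Ring R] : Prop :=
  ∀ S : Set R, S.Nonempty →
    ∃ e : R, e * e = e ∧ leftAnn S = {x : R | ∃ r : R, x = r * e}

/-- `R` is Baer (right annihilator version): the right annihilator of every
nonempty subset is of the form `eR` for an idempotent `e`. -/
def IsBaerRight (R : Type*) [Ring R] : Prop :=
  ∀ S : Set R, S.Nonempty →
    ∃ e : R, e * e = e ∧ rightAnn S = {x : R | ∃ r : R, x = e * r}

/-- `R` is quasi-Baer: the right annihilator of every right ideal
(an additive subgroup closed under right multiplication) is of the form `eR`
for an idempotent `e`. -/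
def IsQuasiBaer (R : Type*) [Ring R] : Prop :=
  ∀ I : AddSubgroup R, (∀ a ∈ I, ∀ r : R, a * r ∈ I) →
    ∃ e : R, e * e = e ∧ rightAnn (I : Set R) = {x : R | ∃ r : R, x = e * r}

theorem famPow_succ {R : Type*} {n : ℕ} [Ring R] (σ : Fin (n + 1) → R → R)
    (α : Fin (n + 1) → ℕ) (x : R) :
    famPow σ α x = (σ 0)^[α 0] (famPow (fun i => σ i.succ) (fun i => α i.succ) x) := by
  simp [famPow, List.ofFn_succ]

theorem famPow_zero {R : Type*} [Ring R] {n : ℕ} (σ : Fin n → R → R) (x : R) :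
    famPow σ 0 x = x := by
  induction n with
  | zero => simp [famPow]
  | succ n ih =>
    rw [famPow_succ]
    exact ih _

theorem famPow_single {R : Type*} [Ring R] {n : ℕ} (σ : Fin n → R → R) (i : Fin n) (x : R) :
    famPow σ (Pi.single i 1) x = σ i x := by
  induction n with
  | zero => exact i.elim0
  | succ n ih =>
    rw [famPow_succ]
    cases i using Fin.cases with
    | zero =>
      have h : (fun j : Fin n => (Pi.single 0 1 : Fin (n + 1) → ℕ) j.succ) = 0 := by
        ext j
        simp
      rw [h, famPow_zero]
      simp
    | succ i =>
      have h : (fun j : Fin n => (Pi.single i.succ 1 : Fin (n + 1) → ℕ) j.succ) =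
          Pi.single i 1 := by
        ext j
        simp [Pi.single_apply]
      rw [h, ih]
      simp

/-- If every map of the family sends both `0` and `x` to `0`, so does every nontrivial
composition of them. -/
theorem famPow_eq_zero {R : Type*} [Ring R] {n : ℕ} (δ : Fin n → R → R) {x : R}
    (h_zero : ∀ i, δ i 0 = 0) (hx : ∀ i, δ i x = 0) (β : Fin n → ℕ) (hβ : β ≠ 0) :
    famPow δ β x = 0 := by
  induction n with
  | zero => exact absurd (Subsingleton.elim β 0) hβ
  | succ n ih =>
    rw [famPow_succ]
    by_cases h : (fun i : Fin n => β i.succ) = 0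
    · rw [h, famPow_zero]
      obtain ⟨k, hk⟩ : ∃ k, β 0 = k + 1 := by
        refine Nat.exists_eq_succ_of_ne_zero fun h0 => hβ (funext fun i => ?_)
        cases i using Fin.cases with
        | zero => exact h0
        | succ i => exact congrFun h i
      rw [hk, Function.iterate_succ_apply, hx, Function.iterate_fixed (h_zero 0)]
    · rw [ih _ (fun i => h_zero _) (fun i => hx _) _ h, Function.iterate_fixed (h_zero 0)]

theorem SigmaSemicomm.single {R : Type*} [Ring R] {n : ℕ} {σ : Fin n → R → R}
    (h : SigmaSemicomm σ) (i : Fin n) : SingleSemicomm (σ i) := by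
  intro a b hab r
  simpa [famPow_single] using h a b hab r (Pi.single i 1) (by simp)

theorem IsNUEnd.map_one_sub {R : Type*} [Ring R] {σ : R → R} (hσ : IsNUEnd σ) (x : R) :
    σ (1 - x) = σ 1 - σ x := by
  rw [eq_sub_iff_add_eq, ← hσ.1, sub_add_cancel]

theorem SingleSemicomm.map_idempotent {R : Type*} [Ring R] {σ : R → R} (hσ : IsNUEnd σ)
    (h : SingleSemicomm σ) {e : R} (he : e * e = e) : σ e = e * σ 1 := by
  have h₁ := h e (1 - e) (by rw [mul_sub, mul_one, he, sub_self]) 1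
  have h₂ := h (1 - e) e (by rw [sub_mul, one_mul, he, sub_self]) 1
  rw [mul_one, hσ.map_one_sub, mul_sub, sub_eq_zero] at h₁
  rw [mul_one, sub_mul, one_mul, sub_eq_zero] at h₂
  rw [h₂, h₁]

theorem SingleSemicomm.map_one {R : Type*} [Ring R] {σ : R → R} (hσ : IsNUEnd σ)
    (hinj : Function.Injective σ) (h : SingleSemicomm σ) : σ 1 = 1 := by
  have hc : σ 1 * σ 1 = σ 1 := by rw [← hσ.2, mul_one]
  exact hinj ((h.map_idempotent hσ hc).trans hc)

theorem SingleSemicomm.commute_idempotent {R : Type*} [Ring R] {σ : R → R} (hσ : IsNUEnd σ)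
    (hinj : Function.Injective σ) (h : SingleSemicomm σ) {e : R} (he : e * e = e) (r : R) :
    e * r = r * e := by
  have h_one := h.map_one hσ hinj
  have h_map : σ e = e := by rw [h.map_idempotent hσ he, h_one, mul_one]
  have h₁ := h e (1 - e) (by rw [mul_sub, mul_one, he, sub_self]) r
  have h₂ := h (1 - e) e (by rw [sub_mul, one_mul, he, sub_self]) r
  rw [hσ.map_one_sub, h_one, h_map, mul_sub, mul_one, sub_eq_zero] at h₁
  rw [h_map, sub_mul, sub_mul, one_mul, sub_eq_zero] at h₂
  rw [h₁, h₂]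

theorem IsSigmaDerivation.map_idempotent {R : Type*} [Ring R] {σ δ : R → R} (hσ : IsNUEnd σ)
    (hinj : Function.Injective σ) (h : SingleSemicomm σ) (hδ : IsSigmaDerivation σ δ) {e : R}
    (he : e * e = e) : δ e = 0 := by
  have h_eq := hδ.2 e e
  rw [he, h.map_idempotent hσ he, h.map_one hσ hinj, mul_one,
    ← h.commute_idempotent hσ hinj he] at h_eq
  have h_mul : e * δ e = 0 := by
    have h' := congrArg (e * ·) h_eq
    simpa [mul_add, ← mul_assoc, he] using h'
  rw [h_eq, h_mul, add_zero]

/-- over a `Σ`-semicommutative ring, any `σᵢ`-derivations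
kill idempotents: `δᵢ(e) = 0`, and `δ^β(e) = 0` for `β ≠ 0`. -/
theorem sigma_semicomm_derivation_idempotent {R : Type*} [Ring R] {n : ℕ}
    (σ : Fin n → R → R) (δ : Fin n → R → R)
    (hσ : ∀ i, IsNUEnd (σ i)) (hinj : ∀ i, Function.Injective (σ i))
    (hδ : ∀ i, IsSigmaDerivation (σ i) (δ i))
    (hsc : SigmaSemicomm σ) :
    ∀ e : R, e * e = e →
      (∀ i : Fin n, δ i e = 0) ∧
        (∀ β : Fin n → ℕ, β ≠ 0 → famPow δ β e = 0) := by
  intro e he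
  have h_map : ∀ i, δ i e = 0 := fun i =>
    (hδ i).map_idempotent (hσ i) (hinj i) (hsc.single i) he
  have h_zero : ∀ i, δ i 0 = 0 := fun i => by simpa using (hδ i).1 0 0
  exact ⟨h_map, famPow_eq_zero δ h_zero h_map⟩
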